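/- Let n ≥ 1 and C₁, C₂ > 0. There exist constants C₁′, C₂′ > 0, depending only on n, C₁ and C₂, such that for every continuous function f : ℝⁿ → ℝ with support contained in the Euclidean ball of radius C₁ centered at 0, with ∫_{ℝⁿ} f(x) dx = 0 and ‖f‖_{L¹} ≤ C₂, there exist integrable functions f₁, f₂, …, fₙ on ℝⁿ, each supported in the Euclidean ball of radius C₁′ centered at 0 and with ‖f_i‖_{L¹} ≤ C₂′, such that f = ∑_{i=1}^n ∂_{x_i} f_i in the sense of distributions. -/

import Mathlib

open MeasureTheory Set

noncomputable section

/-- Euclidean space `ℝⁿ`. -/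
abbrev Eu (n : ℕ) := EuclideanSpace ℝ (Fin n)

/-- The average `∫₀¹ t⁻ⁿ H(z / t) dt`, which is the density of the push-forward of
`H(x) dx dt` under `(t, x) ↦ t x`, for `0 < t ≤ 1`. -/
def radialAverage {n : ℕ} (H : Eu n → ℝ) (z : Eu n) : ℝ :=
  ∫ t in Ioc (0 : ℝ) 1, (t ^ n)⁻¹ * H (t⁻¹ • z)

lemma integral_dilation {n : ℕ} (H : Eu n → ℝ) {t : ℝ} (ht : 0 < t) :
    ∫ z, (t ^ n)⁻¹ * H (t⁻¹ • z) = ∫ x, H x := by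
  have htn : 0 < t ^ n := pow_pos ht n
  rw [integral_const_mul, Measure.integral_comp_smul]
  simp only [finrank_euclideanSpace, Fintype.card_fin, inv_pow, inv_inv, smul_eq_mul,
    abs_of_pos htn]
  field_simp

lemma integrable_dilation {n : ℕ} {H : Eu n → ℝ} (hH : Continuous H) (hi : Integrable H) :
    Integrable (fun p : ℝ × Eu n => (p.1 ^ n)⁻¹ * H (p.1⁻¹ • p.2))
      ((volume.restrict (Ioc (0 : ℝ) 1)).prod volume) := by
  have hm : Measurable (fun p : ℝ × Eu n => (p.1 ^ n)⁻¹ * H (p.1⁻¹ • p.2)) := by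
    have := hH.measurable
    fun_prop
  rw [integrable_prod_iff hm.aestronglyMeasurable]
  constructor
  · filter_upwards [ae_restrict_mem measurableSet_Ioc] with t ht
    exact (hi.comp_smul (inv_ne_zero ht.1.ne')).const_mul _
  · refine (integrable_const (∫ x, |H x|)).congr ?_
    filter_upwards [ae_restrict_mem measurableSet_Ioc] with t ht
    rw [← integral_dilation (fun x => |H x|) ht.1]
    simp [abs_of_pos ht.1]

lemma integrable_radialAverage {n : ℕ} {H : Eu n → ℝ} (hH : Continuous H)
    (hi : Integrable H) : Integrable (radialAverage H) :=
  (integrable_dilation hH hi).integral_prod_right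

lemma integral_abs_radialAverage_le {n : ℕ} {H : Eu n → ℝ} (hH : Continuous H)
    (hi : Integrable H) : ∫ z, |radialAverage H z| ≤ ∫ x, |H x| := by
  have hK := integrable_dilation hH hi
  calc ∫ z, |radialAverage H z|
      ≤ ∫ z, ∫ t in Ioc (0 : ℝ) 1, |(t ^ n)⁻¹ * H (t⁻¹ • z)| :=
        integral_mono (integrable_radialAverage hH hi).abs hK.abs.integral_prod_right
          fun z => abs_integral_le_integral_abs
    _ = ∫ t in Ioc (0 : ℝ) 1, ∫ z, |(t ^ n)⁻¹ * H (t⁻¹ • z)| :=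
        (integral_integral_swap (f := fun t z => |(t ^ n)⁻¹ * H (t⁻¹ • z)|) hK.abs).symm
    _ = ∫ t in Ioc (0 : ℝ) 1, ∫ x, |H x| := by
        refine setIntegral_congr_fun measurableSet_Ioc fun t ht => ?_
        rw [← integral_dilation (fun x => |H x|) ht.1]
        simp [abs_mul, abs_of_pos ht.1]
    _ = ∫ x, |H x| := by simp

lemma norm_le_of_radialAverage_ne_zero {n : ℕ} {H : Eu n → ℝ} {C : ℝ}
    (hs : ∀ x, H x ≠ 0 → ‖x‖ ≤ C) {z : Eu n} (hz : radialAverage H z ≠ 0) : ‖z‖ ≤ C := by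
  by_contra hlt
  refine hz (setIntegral_eq_zero_of_forall_eq_zero fun t ht => ?_)
  by_contra hne
  have h := hs _ (right_ne_zero_of_mul hne)
  rw [norm_smul, norm_inv, Real.norm_of_nonneg ht.1.le] at h
  have : ‖z‖ ≤ t⁻¹ * ‖z‖ :=
    le_mul_of_one_le_left (norm_nonneg z) ((one_le_inv₀ ht.1).2 ht.2)
  exact hlt (this.trans h)

lemma integral_radialAverage_mul {n : ℕ} {H φ : Eu n → ℝ} (hH : Continuous H)
    (hi : Integrable H) (hφ : Continuous φ) {C : ℝ} (hC : ∀ x, ‖φ x‖ ≤ C) :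
    ∫ z, radialAverage H z * φ z = ∫ t in Ioc (0 : ℝ) 1, ∫ x, H x * φ (t • x) := by
  have hK : Integrable (fun p : ℝ × Eu n => (p.1 ^ n)⁻¹ * H (p.1⁻¹ • p.2) * φ p.2)
      ((volume.restrict (Ioc (0 : ℝ) 1)).prod volume) :=
    (integrable_dilation hH hi).mul_bdd (c := C) (by fun_prop) (Filter.Eventually.of_forall fun p => hC _)
  calc ∫ z, radialAverage H z * φ z
      = ∫ z, ∫ t in Ioc (0 : ℝ) 1, (t ^ n)⁻¹ * H (t⁻¹ • z) * φ z := by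
        simp only [radialAverage, integral_mul_const]
    _ = ∫ t in Ioc (0 : ℝ) 1, ∫ z, (t ^ n)⁻¹ * H (t⁻¹ • z) * φ z :=
        (integral_integral_swap (f := fun t z => (t ^ n)⁻¹ * H (t⁻¹ • z) * φ z) hK).symm
    _ = ∫ t in Ioc (0 : ℝ) 1, ∫ x, H x * φ (t • x) := by
        refine setIntegral_congr_fun measurableSet_Ioc fun t ht => ?_
        beta_reduce
        rw [← integral_dilation (fun x => H x * φ (t • x)) ht.1]
        simp only [smul_inv_smul₀ ht.1.ne', mul_assoc]

lemma integral_fderiv_smul {n : ℕ} {g : Eu n → ℝ} (hg : ContDiff ℝ 1 g) (x : Eu n) :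
    ∫ t in Ioc (0 : ℝ) 1, fderiv ℝ g (t • x) x = g x - g 0 := by
  have hcont : Continuous fun t : ℝ => fderiv ℝ g (t • x) x :=
    ((hg.continuous_fderiv one_ne_zero).comp (by fun_prop)).clm_apply continuous_const
  have hderiv : ∀ t ∈ uIcc (0 : ℝ) 1,
      HasDerivAt (fun t : ℝ => g (t • x)) (fderiv ℝ g (t • x) x) t := fun t _ => by
    have h1 : HasDerivAt (fun t : ℝ => t • x) x t := by
      simpa using (hasDerivAt_id t).smul_const x
    exact ((hg.differentiable one_ne_zero) (t • x)).hasFDerivAt.comp_hasDerivAt t h1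
  rw [← intervalIntegral.integral_of_le zero_le_one,
    intervalIntegral.integral_eq_sub_of_hasDerivAt hderiv (hcont.intervalIntegrable _ _)]
  simp

lemma fderiv_apply_eq_sum {n : ℕ} (g : Eu n → ℝ) (y x : Eu n) :
    fderiv ℝ g y x = ∑ i, x i * fderiv ℝ g y (EuclideanSpace.single i 1) := by
  conv_lhs => rw [← (EuclideanSpace.basisFun (Fin n) ℝ).sum_repr x]
  simp

/-- **Lemma 3.** A continuous function supported in `B(0,C₁)` with vanishing
integral and `‖f‖₁ ≤ C₂` can be written as `f = ∑ᵢ ∂_{xᵢ} fᵢ` (distributionally),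
with `fᵢ` supported in `B(0,C₁′)` and `‖fᵢ‖₁ ≤ C₂′`, where `C₁′, C₂′` depend only
on `n`, `C₁`, `C₂`. -/
theorem statement8 (n : ℕ) (hn : 1 ≤ n) (C₁ C₂ : ℝ) (hC₁ : 0 < C₁) (hC₂ : 0 < C₂) :
    ∃ C₁' C₂' : ℝ, 0 < C₁' ∧ 0 < C₂' ∧
      ∀ f : Eu n → ℝ, Continuous f →
        (∀ x, f x ≠ 0 → ‖x‖ ≤ C₁) → Integrable f → (∫ x, f x) = 0 →
        (∫ x, |f x|) ≤ C₂ →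
        ∃ F : Fin n → Eu n → ℝ,
          (∀ i, Integrable (F i)) ∧
          (∀ i x, F i x ≠ 0 → ‖x‖ ≤ C₁') ∧
          (∀ i, (∫ x, |F i x|) ≤ C₂') ∧
          (∀ g : Eu n → ℝ, ContDiff ℝ (⊤ : ℕ∞) g → HasCompactSupport g →
            ∫ x, f x * g x =
              -∑ i : Fin n, ∫ x, F i x * fderiv ℝ g x (EuclideanSpace.single i 1)) := by
  refine ⟨C₁, C₁ * C₂, hC₁, mul_pos hC₁ hC₂, fun f hf hs hi h0 h1 => ?_⟩
  have hHc : ∀ i, Continuous fun x : Eu n => f x * x i := fun i => by fun_prop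
  have hHle : ∀ i (x : Eu n), |f x * x i| ≤ C₁ * |f x| := fun i x => by
    by_cases hx : f x = 0
    · simp [hx]
    · rw [abs_mul, mul_comm]
      gcongr
      exact (PiLp.norm_apply_le x i).trans (hs x hx)
  have hHi : ∀ i, Integrable fun x : Eu n => f x * x i := fun i =>
    (hi.abs.const_mul C₁).mono' (hHc i).aestronglyMeasurable
      (Filter.Eventually.of_forall (hHle i))
  refine ⟨fun i z => -radialAverage (fun x => f x * x i) z,
    fun i => (integrable_radialAverage (hHc i) (hHi i)).neg, fun i z hz => ?_, fun i => ?_,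
    fun g hg hgc => ?_⟩
  · exact norm_le_of_radialAverage_ne_zero (fun x hx => hs x (left_ne_zero_of_mul hx))
      (neg_ne_zero.1 hz)
  · simp only [abs_neg]
    calc _ ≤ ∫ x, |f x * x i| := integral_abs_radialAverage_le (hHc i) (hHi i)
      _ ≤ ∫ x, C₁ * |f x| := integral_mono (hHi i).abs (hi.abs.const_mul C₁) (hHle i)
      _ ≤ C₁ * C₂ := by rw [integral_const_mul]; gcongr
  · have hg1 : ContDiff ℝ 1 g := hg.of_le (by exact_mod_cast le_top)
    have hDc : ∀ i, Continuous fun x => fderiv ℝ g x (EuclideanSpace.single i 1) := fun i =>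
      (hg1.continuous_fderiv one_ne_zero).clm_apply continuous_const
    have hbound : ∀ i, ∃ C, ∀ x, ‖fderiv ℝ g x (EuclideanSpace.single i 1)‖ ≤ C := fun i =>
      (hgc.fderiv_apply ℝ (EuclideanSpace.single i 1)).exists_bound_of_continuous (hDc i)
    choose C hC using hbound
    have hprod : ∀ i, Integrable (fun p : ℝ × Eu n =>
        f p.2 * p.2 i * fderiv ℝ g (p.1 • p.2) (EuclideanSpace.single i 1))
        ((volume.restrict (Ioc (0 : ℝ) 1)).prod volume) := fun i =>
      ((hHi i).comp_snd _).mul_bdd (c := C i)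
        ((hDc i).comp (continuous_fst.smul continuous_snd)).aestronglyMeasurable
        (Filter.Eventually.of_forall fun p => hC i _)
    have hgi : Integrable fun x => f x * g x := by
      obtain ⟨M, hM⟩ := hgc.exists_bound_of_continuous hg.continuous
      exact hi.mul_bdd (c := M) hg.continuous.aestronglyMeasurable (Filter.Eventually.of_forall hM)
    have key : ∀ i, ∫ x, radialAverage (fun x => f x * x i) x *
        fderiv ℝ g x (EuclideanSpace.single i 1) =
        ∫ x, ∫ t in Ioc (0 : ℝ) 1,
          f x * x i * fderiv ℝ g (t • x) (EuclideanSpace.single i 1) := fun i => by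
      rw [integral_radialAverage_mul (hHc i) (hHi i) (hDc i) (hC i)]
      exact integral_integral_swap (f := fun (t : ℝ) (x : Eu n) =>
        f x * x i * fderiv ℝ g (t • x) (EuclideanSpace.single i 1)) (hprod i)
    simp only [neg_mul, integral_neg, Finset.sum_neg_distrib, neg_neg, key]
    rw [← integral_finsetSum _ fun i _ => (hprod i).integral_prod_right]
    have hpt : ∀ x : Eu n, ∑ i, ∫ t in Ioc (0 : ℝ) 1,
        f x * x i * fderiv ℝ g (t • x) (EuclideanSpace.single i 1) =
        f x * g x - f x * g 0 := fun x => by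
      rw [← mul_sub, ← integral_fderiv_smul hg1 x, ← integral_const_mul, ← integral_finsetSum]
      · simp only [fderiv_apply_eq_sum g _ x, Finset.mul_sum, mul_assoc]
      · intro i _
        have : Continuous fun t : ℝ =>
            f x * x i * fderiv ℝ g (t • x) (EuclideanSpace.single i 1) :=
          continuous_const.mul ((hDc i).comp (by fun_prop))
        exact (this.integrableOn_Icc (a := 0) (b := 1)).mono_set Ioc_subset_Icc_self
    simp only [hpt]
    rw [integral_sub hgi (hi.mul_const _), integral_mul_const, h0, zero_mul, sub_zero]
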